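/- Let B_0, B_1 be unitary n×n matrices with B_0^d = B_1^d = 𝟙_n, and let ψ ∈ ℂ^d ⊗ ℂ^n ⊗ ℂ^m be a unit vector satisfying (Z_d^k ⊗ B_0^k ⊗ 𝟙_m) ψ = ψ for every k = 1,…,d−1 and ( [∑_{k=1}^{d-1} ( γ(α)·X_d^k ⊗ B_1^k + δ_k(α)·Z_d^k ⊗ 𝟙_n )] ⊗ 𝟙_m ) ψ = ψ. Then ( 𝟙_d ⊗ (B_0B_1 − ω^{−1}B_1B_0) ⊗ 𝟙_m ) ψ = 0; if moreover the reduced density matrix ρ_B of ψ on the middle factor is invertible, then B_0B_1 = ω^{−1} B_1B_0. -/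

import Mathlib

open Matrix Kronecker Finset
open scoped ComplexOrder

noncomputable section

/-- `ω = exp(2πi/d)`. -/
def om (d : ℕ) : ℂ := Complex.exp (2 * Real.pi * Complex.I / d)

/-- The generalized Pauli matrix `Z_d = ∑_i ω^i |i⟩⟨i|`. -/
def Zd (d : ℕ) : Matrix (Fin d) (Fin d) ℂ :=
  Matrix.diagonal fun i => om d ^ (i : ℕ)

/-- The generalized Pauli matrix `X_d = ∑_i |i+1 mod d⟩⟨i|`. -/
def Xd (d : ℕ) : Matrix (Fin d) (Fin d) ℂ :=
  Matrix.of fun i j => if (i : ℕ) = ((j : ℕ) + 1) % d then 1 else 0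

/-- `γ(α) = d / ∑_{i≠j} α_i/α_j` (sum over ordered pairs `i ≠ j`). -/
def gam (d : ℕ) (α : Fin d → ℝ) : ℝ :=
  d / ∑ i : Fin d, ∑ j : Fin d, if i ≠ j then α i / α j else 0

/-- `δ_k(α) = -(γ(α)/d) ∑_{i≠j} (α_i/α_j) ω^{k(d-j)}`. -/
def delt (d : ℕ) (α : Fin d → ℝ) (k : ℕ) : ℂ :=
  -(((gam d α : ℝ) : ℂ) / d) * ∑ i : Fin d, ∑ j : Fin d,
    if i ≠ j then ((α i / α j : ℝ) : ℂ) * om d ^ (k * (d - (j : ℕ))) else 0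

/-- The reduced density matrix on the middle factor of a vector `ψ ∈ ℂ^d ⊗ ℂ^n ⊗ ℂ^m`:
`ρ_B[b,b'] = ∑_{a,e} ψ_{a,b,e}·conj(ψ_{a,b',e})`. -/
def rhoB (d n m : ℕ) (ψ : (Fin d × Fin n) × Fin m → ℂ) : Matrix (Fin n) (Fin n) ℂ :=
  Matrix.of fun b b' => ∑ a : Fin d, ∑ e : Fin m, ψ ((a, b), e) * (starRingEnd ℂ) (ψ ((a, b'), e))


lemma om_pow (d : ℕ) [NeZero d] : om d ^ d = 1 :=
  (Complex.isPrimitiveRoot_exp d (NeZero.ne d)).pow_eq_one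

lemma om_prim (d : ℕ) [NeZero d] : IsPrimitiveRoot (om d) d :=
  Complex.isPrimitiveRoot_exp d (NeZero.ne d)

lemma modCase (d x y : ℕ) (hx : x < d) (hy : y ≤ d) (hd : 0 < d) :
    (x + y < d ∧ (x + y) % d = x + y) ∨ (d ≤ x + y ∧ (x + y) % d = x + y - d) := by
  by_cases h : x + y < d
  · exact Or.inl ⟨h, Nat.mod_eq_of_lt h⟩
  · right
    refine ⟨by omega, ?_⟩
    rw [Nat.mod_eq_sub_mod (by omega), Nat.mod_eq_of_lt (by omega)]

lemma Xd_pow (d : ℕ) [NeZero d] (k : ℕ) (i j : Fin d) :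
    (Xd d ^ k) i j = if (i : ℕ) = ((j : ℕ) + k) % d then 1 else 0 := by
  induction k generalizing j with
  | zero =>
    simp [Matrix.one_apply, Nat.mod_eq_of_lt j.2, Fin.ext_iff]
  | succ k ih =>
    rw [pow_succ, Matrix.mul_apply]
    have hlt : ((j : ℕ) + 1) % d < d := Nat.mod_lt _ (NeZero.pos d)
    rw [Finset.sum_eq_single (⟨((j : ℕ) + 1) % d, hlt⟩ : Fin d)]
    · rw [ih]
      simp only [Xd, Matrix.of_apply, if_true, mul_one, Nat.mod_add_mod]
      rw [show (j : ℕ) + 1 + k = j + (k + 1) by ring]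
    · intro b _ hb
      have : (b : ℕ) ≠ ((j : ℕ) + 1) % d := fun h => hb (Fin.ext h)
      simp [Xd, this]
    · simp

lemma Zd_pow (d k : ℕ) : Zd d ^ k = Matrix.diagonal fun i : Fin d => om d ^ (k * (i : ℕ)) := by
  rw [Zd, Matrix.diagonal_pow]
  congr 1
  funext i
  simp [← pow_mul, mul_comm]

lemma kron_apply (d n m : ℕ) (A : Matrix (Fin d) (Fin d) ℂ) (B : Matrix (Fin n) (Fin n) ℂ)
    (ψ : (Fin d × Fin n) × Fin m → ℂ) (a : Fin d) (b : Fin n) (e : Fin m) :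
    ((A ⊗ₖ B) ⊗ₖ (1 : Matrix (Fin m) (Fin m) ℂ)).mulVec ψ ((a, b), e)
      = ∑ a', A a a' * (B.mulVec fun b' => ψ ((a', b'), e)) b := by
  simp [Matrix.mulVec, dotProduct, Fintype.sum_prod_type, Matrix.one_apply, Finset.mul_sum,
    mul_assoc]

lemma count_k (d : ℕ) (a a' : Fin d) (u : ℂ) :
    (∑ k ∈ Finset.Ico 1 d, if (a : ℕ) = ((a' : ℕ) + k) % d then u else 0)
      = if a ≠ a' then u else 0 := by
  have ha := a.2
  have ha' := a'.2
  by_cases h : a = a'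
  · subst h
    simp only [ne_eq, not_true_eq_false, if_false]
    apply Finset.sum_eq_zero
    intro k hk
    rw [Finset.mem_Ico] at hk
    rw [if_neg]
    rcases modCase d a k ha (by omega) (by omega) with h | h <;> omega
  · have h' : (a : ℕ) ≠ a' := fun h'' => h (Fin.ext h'')
    simp only [ne_eq, h, not_false_eq_true, if_true]
    rw [Finset.sum_eq_single (if (a' : ℕ) < a then (a : ℕ) - a' else a + d - a')]
    · rw [if_pos]
      split_ifs with h1
      · rw [Nat.mod_eq_of_lt] <;> omega
      · rw [show (a' : ℕ) + (a + d - a') = a + d by omega]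
        simp [Nat.mod_eq_of_lt ha]
    · intro k hk hne
      rw [Finset.mem_Ico] at hk
      rw [if_neg]
      intro hh
      apply hne
      rcases modCase d a' k ha' (by omega) (by omega) with h | h <;> split_ifs <;> omega
    · intro hk
      exfalso
      apply hk
      rw [Finset.mem_Ico]
      split_ifs <;> omega

lemma geom_k (d : ℕ) [NeZero d] (a j : Fin d) :
    ∑ k ∈ Finset.Ico 1 d, om d ^ (k * (d - (j : ℕ))) * om d ^ (k * (a : ℕ))
      = (if j = a then (d : ℂ) else 0) - 1 := by
  have hdpos := NeZero.pos d
  have h1 : ∀ k, om d ^ (k * (d - (j : ℕ))) * om d ^ (k * (a : ℕ))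
      = (om d ^ (d - (j : ℕ) + a)) ^ k := by
    intro k
    rw [← pow_add, ← pow_mul]; congr 1; ring
  simp_rw [h1]
  have h2 : ∑ k ∈ Finset.range d, (om d ^ (d - (j : ℕ) + a)) ^ k
      = if j = a then (d : ℂ) else 0 := by
    split_ifs with h
    · subst h
      rw [show d - (j : ℕ) + j = d by omega, om_pow]; simp
    · have hne : om d ^ (d - (j : ℕ) + a) ≠ 1 := by
        intro hh
        have hdv := (om_prim d).dvd_of_pow_eq_one _ hh
        have h' : (j : ℕ) ≠ a := fun h'' => h (Fin.ext h'')
        have := a.2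
        have := j.2
        obtain ⟨c, hc⟩ := hdv
        have : c = 1 := by
          have : c < 2 := by
            by_contra hcc
            have : d * 2 ≤ d * c := Nat.mul_le_mul_left d (by omega)
            omega
          have : c ≠ 0 := by rintro rfl; omega
          omega
        subst this
        omega
      rw [geom_sum_eq hne, ← pow_mul, mul_comm, pow_mul, om_pow]; simp
  rw [← h2, Finset.range_eq_Ico, Finset.sum_eq_sum_Ico_succ_bot hdpos]
  simp

lemma S_pos (d : ℕ) (hd : 2 ≤ d) (α : Fin d → ℝ) (hpos : ∀ i, 0 < α i) :
    0 < ∑ i : Fin d, ∑ j : Fin d, if i ≠ j then α i / α j else 0 := by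
  have hnn : ∀ i j : Fin d, 0 ≤ if i ≠ j then α i / α j else 0 := by
    intro i j
    split_ifs
    · exact (div_pos (hpos i) (hpos j)).le
    · exact le_rfl
  apply Finset.sum_pos' (fun i _ => Finset.sum_nonneg fun j _ => hnn i j)
  refine ⟨⟨0, by omega⟩, Finset.mem_univ _, ?_⟩
  apply Finset.sum_pos' (fun j _ => hnn _ j)
  refine ⟨⟨1, by omega⟩, Finset.mem_univ _, ?_⟩
  rw [if_pos (by simp [Fin.ext_iff])]
  exact div_pos (hpos _) (hpos _)

lemma delt_sum (d : ℕ) [NeZero d] (hd : 2 ≤ d) (α : Fin d → ℝ) (hpos : ∀ i, 0 < α i)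
    (a : Fin d) :
    ∑ k ∈ Finset.Ico 1 d, delt d α k * om d ^ (k * (a : ℕ))
      = 1 - (gam d α : ℂ) * (((∑ i, α i) / α a - 1 : ℝ) : ℂ) := by
  have hS := S_pos d hd α hpos
  have hd0 : (d : ℂ) ≠ 0 := Nat.cast_ne_zero.2 (NeZero.ne d)
  have e1 : ∑ k ∈ Finset.Ico 1 d, delt d α k * om d ^ (k * (a : ℕ))
      = -(((gam d α : ℝ) : ℂ) / d) * ∑ i : Fin d, ∑ j : Fin d,
        (((if i ≠ j then α i / α j else 0 : ℝ) : ℂ) * ((if j = a then (d : ℂ) else 0) - 1)) := by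
    simp_rw [← geom_k d a, delt, mul_assoc, ← Finset.mul_sum]
    congr 1
    simp_rw [Finset.sum_mul, Finset.mul_sum]
    rw [Finset.sum_comm]
    refine Finset.sum_congr rfl fun i _ => ?_
    rw [Finset.sum_comm]
    refine Finset.sum_congr rfl fun j _ => ?_
    refine Finset.sum_congr rfl fun k _ => ?_
    split_ifs <;> simp [mul_assoc]
  have e2 : ∑ i : Fin d, (if i ≠ a then α i / α a else 0 : ℝ) = (∑ i, α i) / α a - 1 := by
    have hp : ∀ i : Fin d, (if i ≠ a then α i / α a else 0 : ℝ)
        = α i / α a - (if i = a then 1 else 0) := by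
      intro i
      by_cases h : i = a
      · subst h
        simp [div_self (hpos i).ne']
      · simp [h]
    simp_rw [hp, Finset.sum_sub_distrib, Finset.sum_div]
    simp
  have e3 : ∑ i : Fin d, ∑ j : Fin d,
        (((if i ≠ j then α i / α j else 0 : ℝ) : ℂ) * ((if j = a then (d : ℂ) else 0) - 1))
      = (((∑ i, α i) / α a - 1 : ℝ) : ℂ) * d
        - ((∑ i : Fin d, ∑ j : Fin d, if i ≠ j then α i / α j else 0 : ℝ) : ℂ) := by
    simp_rw [mul_sub, Finset.sum_sub_distrib, mul_one]
    congr 1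
    · rw [← e2]
      push_cast
      rw [Finset.sum_mul]
      refine Finset.sum_congr rfl fun i _ => ?_
      rw [Finset.sum_eq_single a]
      · simp
      · intro b _ hb; simp [hb]
      · simp
    · push_cast; rfl
  rw [e1, e3]
  have e4 : (gam d α : ℂ)
      * ((∑ i : Fin d, ∑ j : Fin d, if i ≠ j then α i / α j else 0 : ℝ) : ℂ) = d := by
    rw [← Complex.ofReal_mul, gam, div_mul_cancel₀ _ hS.ne']; simp
  field_simp
  linear_combination e4

lemma core (d n : ℕ) [NeZero d] (hd : 2 ≤ d)
    (α : Fin d → ℝ) (hpos : ∀ i, 0 < α i)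
    (B0 B1 : Matrix (Fin n) (Fin n) ℂ) (hB1d : B1 ^ d = 1)
    (v : Fin d → Fin n → ℂ)
    (h0 : ∀ a : Fin d, om d ^ (a : ℕ) • B0.mulVec (v a) = v a)
    (h1 : ∀ a : Fin d, ∑ a', (if a ≠ a' then (B1 ^ ((a : ℕ) + (d - a'))).mulVec (v a') else 0)
       = (((∑ i, α i) / α a - 1 : ℝ) : ℂ) • v a) (a : Fin d) :
    (B0 * B1 - (om d)⁻¹ • (B1 * B0)).mulVec (v a) = 0 := by
  have hom : om d ≠ 0 := (om_prim d).ne_zero (NeZero.ne d)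
  set s : ℝ := ∑ i, α i with hs
  have hspos : 0 < s := Finset.sum_pos (fun i _ => hpos i) ⟨a, Finset.mem_univ _⟩
  set T : Fin n → ℂ := ∑ a' : Fin d, (B1 ^ (d - (a' : ℕ))).mulVec (v a') with hT
  have h2 : ∀ a : Fin d, (B1 ^ (a : ℕ)).mulVec T = ((s / α a : ℝ) : ℂ) • v a := by
    intro a
    have : (B1 ^ (a : ℕ)).mulVec T = ∑ a' : Fin d, (B1 ^ ((a : ℕ) + (d - a'))).mulVec (v a') := by
      rw [hT, Matrix.mulVec_sum]
      simp_rw [Matrix.mulVec_mulVec, ← pow_add]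
    rw [this]
    have h3 := h1 a
    have h4 : ∑ a' : Fin d, (B1 ^ ((a : ℕ) + (d - a'))).mulVec (v a')
        = ∑ a', (if a ≠ a' then (B1 ^ ((a : ℕ) + (d - a'))).mulVec (v a') else 0) + v a := by
      have hp : ∀ a' : Fin d, (B1 ^ ((a : ℕ) + (d - a'))).mulVec (v a')
          = (if a ≠ a' then (B1 ^ ((a : ℕ) + (d - a'))).mulVec (v a') else 0)
            + (if a = a' then v a' else 0) := by
        intro a'
        by_cases h : a = a'
        · subst h
          have : (a : ℕ) + (d - a) = d := by have := a.2; omega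
          simp [this, hB1d]
        · simp [h]
      rw [Finset.sum_congr rfl fun a' _ => hp a', Finset.sum_add_distrib]
      simp
    rw [h4, h3]
    push_cast
    rw [sub_smul, one_smul, sub_add_cancel]
  have h5 : ∀ a : Fin d, v a = ((α a / s : ℝ) : ℂ) • (B1 ^ (a : ℕ)).mulVec T := by
    intro a
    rw [h2, smul_smul, ← Complex.ofReal_mul, div_mul_div_cancel₀ hspos.ne',
      div_self (hpos a).ne']
    simp
  have h6 : ∀ a : Fin d, om d ^ (a : ℕ) • B0.mulVec ((B1 ^ (a : ℕ)).mulVec T)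
      = (B1 ^ (a : ℕ)).mulVec T := by
    intro a
    rw [h2, Matrix.mulVec_smul, smul_comm, h0]
  have h7 : om d ^ ((a : ℕ) + 1) • B0.mulVec ((B1 ^ ((a : ℕ) + 1)).mulVec T)
      = (B1 ^ ((a : ℕ) + 1)).mulVec T := by
    by_cases h : (a : ℕ) + 1 < d
    · exact h6 ⟨(a : ℕ) + 1, h⟩
    · have : (a : ℕ) + 1 = d := by have := a.2; omega
      rw [this, hB1d, om_pow]
      have := h6 ⟨0, by omega⟩
      simpa using this
  have h8 := h6 a
  set R := (B1 ^ (a : ℕ)).mulVec T with hR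
  have h9 : (B1 ^ ((a : ℕ) + 1)).mulVec T = B1.mulVec R := by
    rw [hR, Matrix.mulVec_mulVec, pow_succ']
  rw [h9] at h7
  have key : (B0 * B1 - (om d)⁻¹ • (B1 * B0)).mulVec R = 0 := by
    rw [Matrix.sub_mulVec, Matrix.smul_mulVec, ← Matrix.mulVec_mulVec, ← Matrix.mulVec_mulVec,
      sub_eq_zero]
    have hp : om d ^ ((a : ℕ) + 1) ≠ 0 := pow_ne_zero _ hom
    apply smul_right_injective _ hp
    simp only
    rw [h7, smul_smul, pow_succ, mul_assoc, mul_inv_cancel₀ hom, mul_one, ← Matrix.mulVec_smul, h8]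
  rw [h5 a, Matrix.mulVec_smul, key, smul_zero]

/-- the anticommutation relation. If unitary observables `B₀, B₁` with
`B₀^d = B₁^d = 𝟙` satisfy the two fixed-point relations with a unit vector `ψ`, then
`(𝟙_d ⊗ (B₀B₁ − ω⁻¹B₁B₀) ⊗ 𝟙_m) ψ = 0`; if moreover `ρ_B` is invertible then
`B₀B₁ = ω⁻¹ B₁B₀`. -/
theorem commutation_relation (d n m : ℕ) [NeZero d] (hd : 2 ≤ d)
    (α : Fin d → ℝ) (hpos : ∀ i, 0 < α i) (hnorm : ∑ i, α i ^ 2 = 1)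
    (B0 B1 : Matrix (Fin n) (Fin n) ℂ)
    (hB0u : B0ᴴ * B0 = 1) (hB0u' : B0 * B0ᴴ = 1) (hB0d : B0 ^ d = 1)
    (hB1u : B1ᴴ * B1 = 1) (hB1u' : B1 * B1ᴴ = 1) (hB1d : B1 ^ d = 1)
    (ψ : (Fin d × Fin n) × Fin m → ℂ) (hψ : ∑ p, Complex.normSq (ψ p) = 1)
    (hfix0 : ∀ k : ℕ, 1 ≤ k → k ≤ d - 1 →
      (((Zd d ^ k) ⊗ₖ (B0 ^ k)) ⊗ₖ (1 : Matrix (Fin m) (Fin m) ℂ)).mulVec ψ = ψ)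
    (hfix1 : ((∑ k ∈ Finset.Ico 1 d,
        (((gam d α : ℝ) : ℂ) • ((Xd d ^ k) ⊗ₖ (B1 ^ k))
          + delt d α k • ((Zd d ^ k) ⊗ₖ (1 : Matrix (Fin n) (Fin n) ℂ))))
        ⊗ₖ (1 : Matrix (Fin m) (Fin m) ℂ)).mulVec ψ = ψ) :
    (((1 : Matrix (Fin d) (Fin d) ℂ) ⊗ₖ (B0 * B1 - (om d)⁻¹ • (B1 * B0)))
        ⊗ₖ (1 : Matrix (Fin m) (Fin m) ℂ)).mulVec ψ = 0
    ∧ (IsUnit (rhoB d n m ψ) → B0 * B1 = (om d)⁻¹ • (B1 * B0)) := by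
  have hom : om d ≠ 0 := (om_prim d).ne_zero (NeZero.ne d)
  have hd0 : (d : ℝ) ≠ 0 := Nat.cast_ne_zero.2 (NeZero.ne d)
  have hgam : (gam d α : ℂ) ≠ 0 := by
    rw [Complex.ofReal_ne_zero, gam]
    exact div_ne_zero hd0 (S_pos d hd α hpos).ne'
  have hv : ∀ (e : Fin m) (a : Fin d),
      (B0 * B1 - (om d)⁻¹ • (B1 * B0)).mulVec (fun b => ψ ((a, b), e)) = 0 := by
    intro e
    refine core d n hd α hpos B0 B1 hB1d (fun a b => ψ ((a, b), e)) ?_ ?_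
    · intro a
      funext b
      have := congrFun (hfix0 1 le_rfl (by omega)) ((a, b), e)
      rw [kron_apply, Zd_pow] at this
      simpa [Matrix.diagonal_apply] using this
    · intro a
      funext b
      have h := congrFun hfix1 ((a, b), e)
      have hlin : ∀ (f : ℕ → Matrix (Fin d × Fin n) (Fin d × Fin n) ℂ),
          ((∑ k ∈ Finset.Ico 1 d, f k) ⊗ₖ (1 : Matrix (Fin m) (Fin m) ℂ)).mulVec ψ
          = ∑ k ∈ Finset.Ico 1 d, ((f k) ⊗ₖ (1 : Matrix (Fin m) (Fin m) ℂ)).mulVec ψ := by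
        intro f
        rw [← Matrix.sum_mulVec]
        congr 1
        ext p q
        simp [Matrix.sum_apply, Finset.sum_mul]
      rw [hlin, Finset.sum_apply] at h
      simp_rw [Matrix.add_kronecker, Matrix.smul_kronecker, Matrix.add_mulVec, Matrix.smul_mulVec,
        Pi.add_apply, Pi.smul_apply, kron_apply, Zd_pow, Xd_pow, Finset.sum_add_distrib] at h
      simp only [Matrix.one_mulVec, Matrix.diagonal_apply, ite_mul, one_mul, zero_mul,
        Finset.sum_ite_eq, Finset.mem_univ, if_true, smul_eq_mul, ← mul_assoc] at h
      rw [← Finset.sum_mul, delt_sum d hd α hpos, ← Finset.mul_sum, Finset.sum_comm] at h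
      have h' : ∀ a' : Fin d, (∑ k ∈ Finset.Ico 1 d, if (a : ℕ) = ((a' : ℕ) + k) % d then
            ((B1 ^ k).mulVec fun b' => ψ ((a', b'), e)) b else 0)
          = if a ≠ a' then
            ((B1 ^ ((a : ℕ) + (d - a'))).mulVec fun b' => ψ ((a', b'), e)) b else 0 := by
        intro a'
        rw [← count_k]
        refine Finset.sum_congr rfl fun k hk => ?_
        rw [Finset.mem_Ico] at hk
        split_ifs with hh
        · have ha := a.2
          have ha' := a'.2
          have : B1 ^ ((a : ℕ) + (d - a')) = B1 ^ k := by
            rcases modCase d a' k ha' (by omega) (by omega) with h | h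
            · rw [show (a : ℕ) + (d - a') = k + d by omega, pow_add, hB1d, mul_one]
            · rw [show (a : ℕ) + (d - a') = k by omega]
          rw [this]
        · rfl
      simp_rw [h'] at h
      rw [Finset.sum_apply]
      have h3 : ∀ a' : Fin d, (if a ≠ a' then
            ((B1 ^ ((a : ℕ) + (d - a'))).mulVec fun b' => ψ ((a', b'), e)) else 0 : Fin n → ℂ) b
          = if a ≠ a' then
            ((B1 ^ ((a : ℕ) + (d - a'))).mulVec fun b' => ψ ((a', b'), e)) b else 0 := by
        intro a'
        split_ifs <;> rfl
      simp_rw [h3]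
      rw [Pi.smul_apply, smul_eq_mul]
      apply mul_left_cancel₀ hgam
      linear_combination h
  generalize hM : B0 * B1 - (om d)⁻¹ • (B1 * B0) = M at hv ⊢
  refine ⟨?_, ?_⟩
  · funext ⟨⟨a, b⟩, e⟩
    rw [kron_apply]
    simp [hv]
  · intro hu
    have hz : M * rhoB d n m ψ = 0 := by
      ext b b'
      have : ∀ (e : Fin m) (a : Fin d), ∑ c, M b c * ψ ((a, c), e) = 0 := fun e a =>
        congrFun (hv e a) b
      rw [Matrix.mul_apply]
      simp only [rhoB, Matrix.of_apply, Finset.mul_sum]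
      rw [Finset.sum_comm]
      rw [Matrix.zero_apply]
      refine Finset.sum_eq_zero fun a _ => ?_
      rw [Finset.sum_comm]
      refine Finset.sum_eq_zero fun e _ => ?_
      simp_rw [← mul_assoc]
      rw [← Finset.sum_mul, this, zero_mul]
    have hM0 : M = 0 := by
      exact (hu.mul_left_eq_zero).1 hz
    rw [hM0] at hM
    exact sub_eq_zero.1 hM
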